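/- arXiv:math/0401127 — 2 statements merged into one kernel-verified Lean document; each statement's English description precedes it below -/
import Mathlib

section
/- If n - k < m, the matrix k-plane Radon transform is not injective on the Schwartz space: there exists a nonzero Schwartz function ψ on M_{n,m} (e.g., one whose Fourier transform is supported in the open set of rank-m matrices) with ψ̂(ξ,t) = 0 for all ξ ∈ V_{n,n-k} and t ∈ M_{n-k,m}. -/
open MeasureTheory Matrix

attribute [local instance] Matrix.normedAddCommGroup Matrix.normedSpace

noncomputable instance matMeasureSpace {α β : Type*} [Fintype α] [Fintype β] :
    MeasureSpace (Matrix α β ℝ) :=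
  inferInstanceAs (MeasureSpace (α → β → ℝ))

/-- The distinguished frame `ξ₀ = [0; I_{n-k}] ∈ V_{n,n-k}`, with `n = k + l`
realized through the index type `Fin k ⊕ Fin l`. -/
def xi0 (k l : ℕ) : Matrix (Fin k ⊕ Fin l) (Fin l) ℝ := Matrix.fromRows 0 1

open scoped FourierTransform SchwartzMap in
/-- Fourier slice argument: if the Fourier transform of `ψ` vanishes on the orthogonal complement
of the plane `A (U × 0)`, then all integrals of `ψ` over translates of this plane vanish. -/
theorem slice_vanish {E U T : Type*} [NormedAddCommGroup E] [InnerProductSpace ℝ E]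
    [FiniteDimensional ℝ E] [MeasurableSpace E] [BorelSpace E]
    [NormedAddCommGroup U] [NormedSpace ℝ U] [FiniteDimensional ℝ U] [MeasurableSpace U]
    [BorelSpace U] (μ : Measure U) [μ.IsAddHaarMeasure]
    [NormedAddCommGroup T] [InnerProductSpace ℝ T] [FiniteDimensional ℝ T] [MeasurableSpace T]
    [BorelSpace T] (A : (U × T) ≃L[ℝ] E) (ψ : 𝓢(E, ℂ))
    (h : ∀ w : E, (∀ u : U, inner ℝ w (A (u, 0)) = 0) → 𝓕 ψ w = 0) (t : T) :
    ∫ u, ψ (A (u, t)) ∂μ = 0 := by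
  let φ : 𝓢(U × T, ℂ) := SchwartzMap.compCLMOfContinuousLinearEquiv ℂ A ψ
  have hφ : ∀ x, φ x = ψ (A x) := fun x => rfl
  have : (μ.prod (volume : Measure T)).IsAddHaarMeasure := Measure.prod.instIsAddHaarMeasure _ _
  have hint : Integrable φ (μ.prod (volume : Measure T)) := φ.integrable
  let F : T → ℂ := fun t => ∫ u, φ (u, t) ∂μ
  have hFint : Integrable F := hint.integral_prod_right
  have hFcont : Continuous F := by
    obtain ⟨N, hN⟩ : ∃ N : ℕ, Module.finrank ℝ U < N := ⟨_, Nat.lt_succ_self _⟩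
    let C : ℝ := 2 ^ N * (Finset.Iic ((N, 0) : ℕ × ℕ)).sup
      (fun m => SchwartzMap.seminorm ℝ m.1 m.2) φ
    have hC : ∀ x, (1 + ‖x‖) ^ N * ‖φ x‖ ≤ C := fun x => by
      simpa using SchwartzMap.one_add_le_sup_seminorm_apply (𝕜 := ℝ) (m := (N, 0)) (k := N)
        (n := 0) le_rfl le_rfl φ x
    refine continuous_of_dominated (bound := fun u => C * (1 + ‖u‖) ^ (-(N : ℝ))) ?_ ?_ ?_ ?_
    · intro t
      exact (φ.continuous.comp (by fun_prop : Continuous fun u : U => (u, t))).aestronglyMeasurable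
    · intro t
      refine Filter.Eventually.of_forall fun u => ?_
      have h1 : (0 : ℝ) < 1 + ‖u‖ := by positivity
      rw [Real.rpow_neg h1.le, Real.rpow_natCast, ← div_eq_mul_inv, le_div_iff₀ (by positivity),
        mul_comm]
      refine le_trans ?_ (hC (u, t))
      gcongr
      exact norm_fst_le (u, t)
    · exact (integrable_one_add_norm (by exact_mod_cast hN)).const_mul C
    · exact Filter.Eventually.of_forall fun u =>
        φ.continuous.comp (by fun_prop : Continuous fun t : T => (u, t))
  have hmap : (Measure.map A (μ.prod (volume : Measure T))).IsAddHaarMeasure :=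
    A.isAddHaarMeasure_map _
  have hFF : 𝓕 F = 0 := by
    ext b
    let L : E →L[ℝ] ℝ :=
      ((innerSL ℝ b).comp (ContinuousLinearMap.snd ℝ U T)).comp A.symm.toContinuousLinearMap
    let w : E := (InnerProductSpace.toDual ℝ E).symm L
    have hw : ∀ x : U × T, inner ℝ w (A x) = inner ℝ b x.2 := by
      intro x
      simp [w, L]
    have hz : 𝓕 ψ w = 0 := h w fun u => by simp [hw]
    rw [Real.fourier_eq]
    have hint2 : Integrable (fun x : U × T => Real.fourierChar (-inner ℝ x.2 b) • φ x)
        (μ.prod (volume : Measure T)) := by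
      refine (integrable_norm_iff ?_).1 ?_
      · refine Continuous.aestronglyMeasurable ?_
        refine Continuous.smul ?_ φ.continuous
        have hc : Continuous fun x : U × T => -inner ℝ x.2 b := by fun_prop
        exact continuous_subtype_val.comp (Real.continuous_fourierChar.comp hc)
      · simpa using hint.norm
    have e1 : ∫ v : T, Real.fourierChar (-inner ℝ v b) • F v
        = ∫ x : U × T, Real.fourierChar (-inner ℝ x.2 b) • φ x ∂(μ.prod volume) := by
      rw [integral_prod_symm _ hint2]
      refine integral_congr_ae (Filter.Eventually.of_forall fun v => ?_)
      simp only [F, Circle.smul_def]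
      rw [integral_smul]
    rw [e1]
    have e2 : ∫ x : U × T, Real.fourierChar (-inner ℝ x.2 b) • φ x ∂(μ.prod volume)
        = ∫ y : E, Real.fourierChar (-inner ℝ y w) • ψ y
            ∂(Measure.map A (μ.prod (volume : Measure T))) := by
      have := A.toHomeomorph.measurableEmbedding.integral_map (μ := μ.prod (volume : Measure T))
        (fun y : E => Real.fourierChar (-inner ℝ y w) • ψ y)
      refine Eq.trans ?_ this.symm
      refine integral_congr_ae (Filter.Eventually.of_forall fun x => ?_)
      simp only [ContinuousLinearEquiv.coe_toHomeomorph]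
      rw [real_inner_comm w, hw, real_inner_comm b, hφ]
    rw [e2, Measure.isAddLeftInvariant_eq_smul (Measure.map A (μ.prod (volume : Measure T))) volume,
      integral_smul_nnreal_measure]
    rw [SchwartzMap.fourier_coe, Real.fourier_eq] at hz
    rw [hz]
    simp
  have : F = 0 := by
    rw [← hFcont.fourierInv_fourier_eq hFint (by rw [hFF]; exact integrable_zero _ _ _), hFF]
    ext x
    simp [Real.fourierInv_eq]
  exact congrFun this t

/-- Matrices as a Euclidean space. -/
noncomputable def matEuclid (α β : Type*) [Fintype α] [Fintype β] :
    Matrix α β ℝ ≃ₗ[ℝ] EuclideanSpace ℝ (α × β) where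
  toFun M := WithLp.toLp 2 fun p => M p.1 p.2
  invFun x := Matrix.of fun i j => x (i, j)
  map_add' _ _ := rfl
  map_smul' _ _ := rfl
  left_inv _ := rfl
  right_inv _ := rfl

theorem matEuclid_inner {α β : Type*} [Fintype α] [Fintype β] (x y : Matrix α β ℝ) :
    inner ℝ (matEuclid α β x) (matEuclid α β y) = (xᵀ * y).trace := by
  have h1 : ∀ z : Matrix α β ℝ, ∀ p : α × β, (matEuclid α β z) p = z p.1 p.2 := fun _ _ => rfl
  simp only [PiLp.inner_apply, h1,
    Fintype.sum_prod_type, Matrix.trace, Matrix.diag, Matrix.mul_apply, Matrix.transpose_apply]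
  rw [Finset.sum_comm]
  simp [mul_comm]

/-- The parametrization `(u, t) ↦ g [u; t]`. -/
noncomputable def planeEquiv {k l m : ℕ} (g : Matrix (Fin k ⊕ Fin l) (Fin k ⊕ Fin l) ℝ)
    (hg : gᵀ * g = 1) :
    ((Fin k → Fin m → ℝ) × EuclideanSpace ℝ (Fin l × Fin m)) ≃ₗ[ℝ]
      EuclideanSpace ℝ ((Fin k ⊕ Fin l) × Fin m) where
  toFun p := matEuclid _ _ (g * Matrix.fromRows (Matrix.of p.1) ((matEuclid _ _).symm p.2))
  invFun x := (Matrix.of.symm (gᵀ * (matEuclid _ _).symm x).toRows₁,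
    matEuclid _ _ (gᵀ * (matEuclid _ _).symm x).toRows₂)
  map_add' p q := by
    rw [← map_add, ← Matrix.mul_add]
    congr 2
    ext (i | i) j <;> simp
  map_smul' c p := by
    rw [RingHom.id_apply, ← map_smul, ← Matrix.mul_smul]
    congr 2
    ext (i | i) j <;> simp
  left_inv p := by
    simp [← Matrix.mul_assoc, hg]
  right_inv x := by
    have hg' : g * gᵀ = 1 := mul_eq_one_comm.1 hg
    simp [← Matrix.mul_assoc, hg']

theorem det_zero_of_perp {k l m : ℕ} (hlm : l < m)
    (g : Matrix (Fin k ⊕ Fin l) (Fin k ⊕ Fin l) ℝ)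
    (hg : gᵀ * g = 1) (y : Matrix (Fin k ⊕ Fin l) (Fin m) ℝ)
    (h : ∀ u : Matrix (Fin k) (Fin m) ℝ,
      (yᵀ * (g * Matrix.fromRows u (0 : Matrix (Fin l) (Fin m) ℝ))).trace = 0) :
    (yᵀ * y).det = 0 := by
  have hg' : g * gᵀ = 1 := mul_eq_one_comm.1 hg
  set z := gᵀ * y with hz
  have hy : yᵀ * y = zᵀ * z := by
    rw [hz, Matrix.transpose_mul, Matrix.transpose_transpose, Matrix.mul_assoc,
      ← Matrix.mul_assoc g, hg', Matrix.one_mul]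
  have h1 := h z.toRows₁
  have h2 : yᵀ * g = zᵀ := by simp [hz]
  rw [← Matrix.mul_assoc, h2, ← Matrix.fromRows_toRows z, Matrix.transpose_fromRows,
    Matrix.fromCols_mul_fromRows] at h1
  simp only [Matrix.toRows₁_fromRows, Matrix.mul_zero, add_zero] at h1
  have h3 : z.toRows₁ = 0 := by
    rw [← Matrix.conjTranspose_eq_transpose_of_trivial] at h1
    exact Matrix.trace_conjTranspose_mul_self_eq_zero_iff.1 h1
  have h4 : zᵀ * z = z.toRows₂ᵀ * z.toRows₂ := by
    conv_lhs => rw [← Matrix.fromRows_toRows z, Matrix.transpose_fromRows,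
      Matrix.fromCols_mul_fromRows, h3]
    simp
  rw [hy, h4]
  by_contra hne
  have hr := Matrix.rank_of_isUnit _ ((Matrix.isUnit_iff_isUnit_det _).2 (isUnit_iff_ne_zero.2 hne))
  have := (Matrix.rank_mul_le_right z.toRows₂ᵀ z.toRows₂).trans (Matrix.rank_le_height _)
  simp at hr
  omega

theorem exists_frame {k l m : ℕ} (hmn : m ≤ k + l) :
    ∃ J : Matrix (Fin k ⊕ Fin l) (Fin m) ℝ, (Jᵀ * J).det ≠ 0 := by
  let c : Fin m → Fin k ⊕ Fin l := fun i => finSumFinEquiv.symm (Fin.castLE hmn i)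
  have hc : Function.Injective c :=
    finSumFinEquiv.symm.injective.comp (Fin.castLE_injective hmn)
  refine ⟨(1 : Matrix (Fin k ⊕ Fin l) (Fin k ⊕ Fin l) ℝ).submatrix id c, ?_⟩
  have : ((1 : Matrix (Fin k ⊕ Fin l) (Fin k ⊕ Fin l) ℝ).submatrix id c)ᵀ *
      (1 : Matrix (Fin k ⊕ Fin l) (Fin k ⊕ Fin l) ℝ).submatrix id c = 1 := by
    rw [Matrix.transpose_submatrix, Matrix.transpose_one,
      ← Matrix.submatrix_mul _ _ c id c Function.bijective_id, Matrix.one_mul,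
      Matrix.submatrix_one _ hc]
  rw [this]
  simp

open scoped FourierTransform SchwartzMap in
theorem exists_schwartz {k l m : ℕ} (hmn : m ≤ k + l) :
    ∃ ψ : 𝓢(EuclideanSpace ℝ ((Fin k ⊕ Fin l) × Fin m), ℂ), ψ ≠ 0 ∧
      ∀ y : Matrix (Fin k ⊕ Fin l) (Fin m) ℝ, (yᵀ * y).det = 0 → 𝓕 ψ (matEuclid _ _ y) = 0 := by
  obtain ⟨J, hJ⟩ := exists_frame (k := k) (l := l) hmn
  let S : Set (EuclideanSpace ℝ ((Fin k ⊕ Fin l) × Fin m)) :=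
    {x | (((matEuclid _ _).symm x)ᵀ * (matEuclid _ _).symm x).det ≠ 0}
  have hS : IsOpen S := by
    have hc : Continuous fun x : EuclideanSpace ℝ ((Fin k ⊕ Fin l) × Fin m) =>
        (matEuclid _ _).symm x := LinearMap.continuous_of_finiteDimensional
          (matEuclid (Fin k ⊕ Fin l) (Fin m)).symm.toLinearMap
    refine isOpen_ne_fun ?_ continuous_const
    exact (hc.matrix_transpose.matrix_mul hc).matrix_det
  have hJS : matEuclid _ _ J ∈ S := by simpa [S] using hJ
  obtain ⟨f, hf1, hf2, hf3, -, hf4⟩ := exists_contDiff_tsupport_subset (n := ⊤)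
    (hS.mem_nhds hJS)
  let χ : 𝓢(EuclideanSpace ℝ ((Fin k ⊕ Fin l) × Fin m), ℂ) :=
    HasCompactSupport.toSchwartzMap (f := fun x => (f x : ℂ))
      (hf2.comp_left Complex.ofReal_zero) (Complex.ofRealCLM.contDiff.comp hf3)
  have hχ : ∀ x, χ x = (f x : ℂ) := fun _ => rfl
  have hF : 𝓕 (𝓕⁻ χ) = χ := FourierTransform.fourier_fourierInv_eq χ
  refine ⟨𝓕⁻ χ, ?_, ?_⟩
  · intro h0
    have : χ = 0 := by
      rw [← hF, h0]
      exact FourierTransform.fourier_zero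
    have := congrArg (fun q => q (matEuclid _ _ J)) this
    simp [hχ, hf4] at this
  · intro y hy
    rw [hF, hχ]
    have : f (matEuclid _ _ y) = 0 := by
      by_contra hne
      have := hf1 (subset_tsupport f hne)
      simp [S, hy] at this
    simp [this]

/-- if `n - k < m ≤ n` (`n = k + l`, `l < m`), the matrix `k`-plane Radon
transform is not injective on the Schwartz space: there is a nonzero Schwartz function
`ψ` on `M_{n,m}` with `ψ̂(ξ,t) = 0` for all frames `ξ ∈ V_{n,n-k}` and all
`t ∈ M_{n-k,m}`. -/
theorem radon_not_injective (k l m : ℕ) (hk : 0 < k) (hl : 0 < l) (hlm : l < m)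
    (hmn : m ≤ k + l) :
    ∃ ψ : SchwartzMap (Matrix (Fin k ⊕ Fin l) (Fin m) ℝ) ℂ, ψ ≠ 0 ∧
      ∀ (ξ : Matrix (Fin k ⊕ Fin l) (Fin l) ℝ), ξᵀ * ξ = 1 →
      ∀ (g : Matrix (Fin k ⊕ Fin l) (Fin k ⊕ Fin l) ℝ),
        gᵀ * g = 1 → g.det = 1 → g * xi0 k l = ξ →
      ∀ t : Matrix (Fin l) (Fin m) ℝ,
        (∫ u : Matrix (Fin k) (Fin m) ℝ, ψ (g * Matrix.fromRows u t)) = 0 := by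
  obtain ⟨ψ, hψ0, hψ⟩ := exists_schwartz (k := k) (l := l) hmn
  let e : Matrix (Fin k ⊕ Fin l) (Fin m) ℝ ≃L[ℝ] EuclideanSpace ℝ ((Fin k ⊕ Fin l) × Fin m) :=
    (matEuclid _ _).toContinuousLinearEquiv
  refine ⟨SchwartzMap.compCLMOfContinuousLinearEquiv ℂ e ψ, ?_, ?_⟩
  · intro h0
    apply hψ0
    ext x
    have := congrArg (fun q => q (e.symm x)) h0
    have h2 : ψ (e (e.symm x)) = 0 := this
    simpa using h2
  · intro ξ _ g hg _ _ t
    let A : ((Fin k → Fin m → ℝ) × EuclideanSpace ℝ (Fin l × Fin m)) ≃L[ℝ]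
      EuclideanSpace ℝ ((Fin k ⊕ Fin l) × Fin m) := (planeEquiv g hg).toContinuousLinearEquiv
    have key := slice_vanish (volume : Measure (Fin k → Fin m → ℝ)) A ψ ?_
      (matEuclid _ _ t)
    · exact key
    · intro w hw
      obtain ⟨y, rfl⟩ := (matEuclid _ _).surjective w
      refine hψ y (det_zero_of_perp hlm g hg y fun u => ?_)
      rw [← matEuclid_inner]
      exact hw u
end

section
/- For a continuous function f on M_{n,m} with f(x) = O(det(I_m + x'x)^{-λ/2}) and integer 1 ≤ k < n with k ≥ m, the Riesz potential (I^k f)(x) = γ_{n,m}(k)^{-1} ∫ f(x-y) det(y'y)^{(k-n)/2} dy converges absolutely for all x if λ > k + m - 1. -/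
open MeasureTheory Matrix

namespace RieszAux

/-- real spectral theorem, in plain matrix form -/
lemma exists_diag {ι : Type*} [Fintype ι] [DecidableEq ι] (A : Matrix ι ι ℝ) (hA : A.IsHermitian) :
    ∃ (U : Matrix ι ι ℝ) (d : ι → ℝ), Uᵀ * U = 1 ∧ Uᵀ * A * U = diagonal d := by
  refine ⟨hA.eigenvectorUnitary, hA.eigenvalues, ?_, ?_⟩
  · have := Unitary.coe_star_mul_self hA.eigenvectorUnitary
    simpa [star_eq_conjTranspose] using this
  · have := hA.conjStarAlgAut_star_eigenvectorUnitary
    rw [Unitary.conjStarAlgAut_apply] at this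
    simpa [star_eq_conjTranspose, Function.comp_def] using this

lemma posSemidef_conj {ι κ : Type*} [Fintype ι] [Fintype κ]
    {A : Matrix ι ι ℝ} (hA : A.PosSemidef) (Q : Matrix ι κ ℝ) : (Qᵀ * A * Q).PosSemidef := by
  simpa using hA.conjTranspose_mul_mul_same Q

lemma posSemidef_gram {ι κ : Type*} [Fintype ι] [Fintype κ]
    (Q : Matrix ι κ ℝ) : (Qᵀ * Q).PosSemidef := by
  simpa using posSemidef_conjTranspose_mul_self Q

lemma posDef_one_add_gram {ι κ : Type*} [Fintype ι] [Fintype κ] [DecidableEq κ]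
    (Q : Matrix ι κ ℝ) : (1 + Qᵀ * Q).PosDef :=
  Matrix.PosDef.one.add_posSemidef (posSemidef_gram Q)

lemma exists_whiten {ι : Type*} [Fintype ι] [DecidableEq ι] (A : Matrix ι ι ℝ) (hA : A.PosDef) :
    ∃ Q : Matrix ι ι ℝ, Qᵀ * A * Q = 1 := by
  obtain ⟨U, d, hU, hd⟩ := exists_diag A hA.1
  have hUu : IsUnit U := (isUnit_iff_isUnit_det U).2 (isUnit_det_of_left_inverse hU)
  have hpd : (Uᵀ * A * U).PosDef := by
    have := (Matrix.IsUnit.posDef_star_left_conjugate_iff (x := A) hUu).2 hA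
    simpa [star_eq_conjTranspose] using this
  rw [hd, posDef_diagonal_iff] at hpd
  refine ⟨U * diagonal (fun i => (Real.sqrt (d i))⁻¹), ?_⟩
  have : (U * diagonal (fun i => (Real.sqrt (d i))⁻¹))ᵀ * A * (U * diagonal (fun i => (Real.sqrt (d i))⁻¹))
      = diagonal (fun i => (Real.sqrt (d i))⁻¹) * (Uᵀ * A * U) * diagonal (fun i => (Real.sqrt (d i))⁻¹) := by
    rw [transpose_mul, diagonal_transpose]
    simp only [Matrix.mul_assoc]
  rw [this, hd, diagonal_mul_diagonal, diagonal_mul_diagonal, ← diagonal_one]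
  congr 1
  ext i
  have h0 : 0 < Real.sqrt (d i) := Real.sqrt_pos.2 (hpd i)
  have h1 := Real.mul_self_sqrt (hpd i).le
  field_simp
  nlinarith

lemma one_le_det_one_add {ι : Type*} [Fintype ι] [DecidableEq ι] (N : Matrix ι ι ℝ)
    (hN : N.PosSemidef) : 1 ≤ (1 + N).det := by
  obtain ⟨U, d, hU, hd⟩ := exists_diag N hN.1
  have hps := posSemidef_conj hN U
  rw [hd, posSemidef_diagonal_iff] at hps
  have hdet : (U.det) * U.det = 1 := by
    have := congrArg det hU
    simpa using this
  have h2 : (Uᵀ * (1 + N) * U).det = (1 + N).det := by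
    rw [det_mul, det_mul, det_transpose]
    linear_combination (1 + N).det * hdet
  have h3 : Uᵀ * (1 + N) * U = diagonal (fun i => 1 + d i) := by
    rw [Matrix.mul_add, Matrix.add_mul, hd, Matrix.mul_one, hU, ← diagonal_one, diagonal_add]
  rw [← h2, h3, det_diagonal]
  calc (1 : ℝ) = ∏ _i : ι, (1 : ℝ) := by simp
    _ ≤ _ := Finset.prod_le_prod (fun _ _ => zero_le_one) (fun i _ => by have := hps i; linarith)

lemma det_mono {ι : Type*} [Fintype ι] [DecidableEq ι] (A B : Matrix ι ι ℝ)
    (hA : A.PosDef) (hAB : (B - A).PosSemidef) : A.det ≤ B.det := by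
  obtain ⟨Q, hQ⟩ := exists_whiten A hA
  have h1 := one_le_det_one_add _ (posSemidef_conj hAB Q)
  have h2 : 1 + Qᵀ * (B - A) * Q = Qᵀ * B * Q := by
    rw [Matrix.mul_sub, Matrix.sub_mul, hQ]; abel
  rw [h2] at h1
  have h3 := congrArg det hQ
  simp only [det_mul, det_transpose, det_one] at h1 h3
  have hQ2 : 0 ≤ Q.det * Q.det := mul_self_nonneg _
  have hA0 := hA.det_pos
  by_contra! hlt
  have hpos : 0 < Q.det * Q.det := by
    rcases hQ2.lt_or_eq with h | h
    · exact h
    · nlinarith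
  nlinarith

lemma trace_bound {ι κ : Type*} [Fintype ι] [Fintype κ] [DecidableEq κ] (x : Matrix ι κ ℝ) :
    ∃ t : ℝ, 0 ≤ t ∧ (t • (1 : Matrix κ κ ℝ) - xᵀ * x).PosSemidef := by
  obtain ⟨U, d, hU, hd⟩ := exists_diag (xᵀ * x) (posSemidef_gram x).1
  have hps := posSemidef_conj (posSemidef_gram x) U
  rw [hd, posSemidef_diagonal_iff] at hps
  have hU' : U * Uᵀ = 1 := mul_eq_one_comm.1 hU
  refine ⟨∑ i, d i, Finset.sum_nonneg fun i _ => hps i, ?_⟩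
  have : (∑ i, d i) • (1 : Matrix κ κ ℝ) - xᵀ * x
      = Uᵀᵀ * (diagonal (fun j => ∑ i, d i - d j)) * Uᵀ := by
    have e : diagonal (fun j => ∑ i, d i - d j) = (∑ i, d i) • (1 : Matrix κ κ ℝ) - Uᵀ * (xᵀ * x) * U := by
      rw [hd, ← diagonal_one, ← diagonal_smul, diagonal_sub]; simp
    rw [e, transpose_transpose, Matrix.mul_sub, Matrix.sub_mul]
    congr 1
    · simp [hU']
    · calc xᵀ * x = (U * Uᵀ) * (xᵀ * x) * (U * Uᵀ) := by rw [hU']; simp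
        _ = _ := by simp only [Matrix.mul_assoc]
  rw [this]
  apply posSemidef_conj
  rw [posSemidef_diagonal_iff]
  intro j
  have := Finset.single_le_sum (f := d) (fun i _ => hps i) (Finset.mem_univ j)
  simp; linarith

lemma det_compare {ι κ : Type*} [Fintype ι] [Fintype κ] [DecidableEq κ] (x : Matrix ι κ ℝ) :
    ∃ c : ℝ, 0 < c ∧ ∀ y : Matrix ι κ ℝ,
      (1 + yᵀ * y).det ≤ c * (1 + (x - y)ᵀ * (x - y)).det := by
  obtain ⟨t, ht, hps⟩ := trace_bound x
  refine ⟨(2 + 2 * t) ^ Fintype.card κ, by positivity, fun y => ?_⟩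
  rw [← det_smul]
  apply det_mono _ _ (posDef_one_add_gram y)
  obtain ⟨z, rfl⟩ : ∃ z, y = x - z := ⟨x - y, by simp⟩
  rw [sub_sub_cancel]
  have : (2 + 2 * t) • (1 + zᵀ * z) - (1 + (x - z)ᵀ * (x - z))
      = 1 + (2 : ℝ) • (t • (1 : Matrix κ κ ℝ) - xᵀ * x) + (2 * t) • (zᵀ * z) + (x + z)ᵀ * (x + z) := by
    simp only [transpose_sub, transpose_add, Matrix.mul_add, Matrix.add_mul, Matrix.mul_sub, Matrix.sub_mul]
    module
  rw [this]
  exact (((Matrix.PosSemidef.one).add (hps.smul (by norm_num))).add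
    ((posSemidef_gram z).smul (by positivity))).add (posSemidef_gram _)

/-- The simultaneous normal form used for the integration of one column. -/
lemma exists_normal {ι κ : Type*} [Fintype ι] [Fintype κ] [DecidableEq ι] [DecidableEq κ]
    (Y : Matrix ι κ ℝ) (hY : (Yᵀ * Y).det ≠ 0) :
    ∃ (R : Matrix ι ι ℝ) (S : Finset ι), S.card + Fintype.card κ = Fintype.card ι ∧
      Rᵀ * (1 - Y * (1 + Yᵀ * Y)⁻¹ * Yᵀ) * R = 1 ∧
      Rᵀ * (1 - Y * (Yᵀ * Y)⁻¹ * Yᵀ) * R = diagonal (fun i => if i ∈ S then 1 else 0) ∧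
      |R.det| = (1 + Yᵀ * Y).det ^ (1 / 2 : ℝ) := by
  have hE : IsUnit (1 + Yᵀ * Y).det := (posDef_one_add_gram Y).det_pos.ne'.isUnit
  have hD : IsUnit (Yᵀ * Y).det := hY.isUnit
  set A := 1 - Y * (1 + Yᵀ * Y)⁻¹ * Yᵀ with hAdef
  set P := 1 - Y * (Yᵀ * Y)⁻¹ * Yᵀ with hPdef
  have hA1 : A * (1 + Y * Yᵀ) = 1 := by
    have : Y * (1 + Yᵀ * Y)⁻¹ * Yᵀ * (1 + Y * Yᵀ) = Y * ((1 + Yᵀ * Y)⁻¹ * (1 + Yᵀ * Y)) * Yᵀ := by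
      simp only [Matrix.mul_add, Matrix.add_mul, Matrix.mul_one, Matrix.mul_assoc]
    rw [hAdef, Matrix.sub_mul, this, nonsing_inv_mul _ hE]
    simp
  have hG : (1 + Y * Yᵀ).PosDef := by simpa using posDef_one_add_gram Yᵀ
  have hAinv : (1 + Y * Yᵀ)⁻¹ = A := inv_eq_left_inv hA1
  have hAP : A.PosDef := hAinv ▸ hG.inv
  have hPY : P * Y = 0 := by
    rw [hPdef, Matrix.sub_mul, Matrix.mul_assoc _ Yᵀ Y, Matrix.mul_assoc Y, nonsing_inv_mul _ hD]
    simp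
  have hPP : P * P = P := by
    conv_lhs => rw [hPdef]
    rw [Matrix.mul_sub, ← hPdef, Matrix.mul_one, ← Matrix.mul_assoc, ← Matrix.mul_assoc, hPY]
    simp
  have hPsymm : Pᵀ = P := by
    rw [hPdef]
    simp [transpose_nonsing_inv, Matrix.mul_assoc]
  obtain ⟨Q, hQ⟩ := exists_whiten A hAP
  have hQQ : Q * Qᵀ = 1 + Y * Yᵀ := by
    have h1 : (A * Q) * Qᵀ = 1 := mul_eq_one_comm.1 (by rw [← Matrix.mul_assoc, hQ])
    rw [Matrix.mul_assoc] at h1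
    rw [← inv_eq_right_inv h1, ← hAinv, nonsing_inv_nonsing_inv _ hG.det_pos.ne'.isUnit]
  have hPQ : P * (Q * Qᵀ) = P := by
    rw [hQQ, Matrix.mul_add, ← Matrix.mul_assoc, hPY]; simp
  set M := Qᵀ * P * Q with hM
  have hMsymm : M.IsHermitian := by
    simp [IsHermitian, hM, hPsymm, Matrix.mul_assoc]
  have hMM : M * M = M := by
    calc M * M = Qᵀ * ((P * (Q * Qᵀ)) * P) * Q := by simp only [hM, Matrix.mul_assoc]
      _ = M := by rw [hPQ, hPP]
  have hMtr : M.trace = Fintype.card ι - Fintype.card κ := by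
    rw [hM, trace_mul_comm, ← Matrix.mul_assoc, trace_mul_comm, hPQ, hPdef, trace_sub, trace_mul_comm,
      ← Matrix.mul_assoc, mul_nonsing_inv _ hD]
    simp
  obtain ⟨U, d, hU, hd⟩ := exists_diag M hMsymm
  have hU' : U * Uᵀ = 1 := mul_eq_one_comm.1 hU
  have hdd : ∀ i, d i * d i = d i := by
    have : diagonal d * diagonal d = diagonal d := by
      rw [← hd]
      calc _ = Uᵀ * (M * (U * Uᵀ) * M) * U := by simp only [Matrix.mul_assoc]
        _ = _ := by rw [hU', Matrix.mul_one, hMM]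
    rw [diagonal_mul_diagonal] at this
    intro i
    exact congrFun (diagonal_injective this) i
  have hd01 : ∀ i, d i = if i ∈ Finset.univ.filter (fun i => d i ≠ 0) then 1 else 0 := by
    intro i
    by_cases h : d i = 0
    · simp [h]
    · simp only [Finset.mem_filter, Finset.mem_univ, true_and, ne_eq, h, not_false_eq_true, if_true]
      exact mul_left_cancel₀ h (by rw [hdd]; simp)
  have hR1 : (Q * U)ᵀ * A * (Q * U) = 1 := by
    calc _ = Uᵀ * (Qᵀ * A * Q) * U := by simp only [transpose_mul, Matrix.mul_assoc]
      _ = 1 := by rw [hQ, Matrix.mul_one, hU]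
  refine ⟨Q * U, Finset.univ.filter (fun i => d i ≠ 0), ?_, hR1, ?_, ?_⟩
  · have h1 : (diagonal d).trace = M.trace := by
      rw [← hd, trace_mul_comm, ← Matrix.mul_assoc, hU', Matrix.one_mul]
    have h2 : (diagonal d).trace = ((Finset.univ.filter (fun i => d i ≠ 0)).card : ℝ) := by
      rw [trace_diagonal, Finset.sum_congr rfl (fun i _ => hd01 i), Finset.sum_ite_mem]
      simp
    rw [h2, hMtr] at h1
    have h3 : (((Finset.univ.filter (fun i => d i ≠ 0)).card : ℕ) : ℝ) + Fintype.card κ = Fintype.card ι := by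
      linarith
    exact_mod_cast h3
  · calc _ = Uᵀ * M * U := by simp only [hM, transpose_mul, Matrix.mul_assoc]
      _ = diagonal d := hd
      _ = _ := by congr 1; ext i; exact hd01 i
  · have h1 := congrArg det hR1
    have h2 := congrArg det hA1
    have h4 : (1 + Y * Yᵀ).det = (1 + Yᵀ * Y).det := det_one_add_mul_comm _ _
    rw [det_mul, det_mul, det_transpose] at h1
    rw [det_mul, h4] at h2
    simp only [det_one] at h1 h2
    have h3 : (1 + Yᵀ * Y).det = (Q * U).det ^ 2 := by
      linear_combination (Q * U).det ^ 2 * h2 - (1 + Yᵀ * Y).det * h1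
    rw [h3, ← Real.sqrt_eq_rpow, Real.sqrt_sq_eq_abs]


lemma integrable_one_dim (e a : ℝ) (he : 0 ≤ e) (he1 : e < 1) (ha : 0 ≤ a) (hea : 1 < e + a) :
    Integrable (fun t : ℝ => (t ^ 2) ^ (-e / 2) * (1 + t ^ 2) ^ (-a / 2)) := by
  have hmeas : Measurable (fun t : ℝ => (t ^ 2) ^ (-e / 2) * (1 + t ^ 2) ^ (-a / 2)) := by fun_prop
  have hpos : ∀ t : ℝ, 0 ≤ (t ^ 2) ^ (-e / 2) * (1 + t ^ 2) ^ (-a / 2) := fun t => by positivity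
  have key : ∀ t : ℝ, 0 < t → (t ^ 2) ^ (-e / 2) = t ^ (-e) := fun t ht => by
    rw [← Real.rpow_natCast, ← Real.rpow_mul ht.le]; congr 1; push_cast; ring
  have h1 : IntegrableOn (fun t : ℝ => (t ^ 2) ^ (-e / 2) * (1 + t ^ 2) ^ (-a / 2)) (Set.Ioc 0 1) := by
    have : IntegrableOn (fun t : ℝ => t ^ (-e)) (Set.Ioc 0 1) :=
      (intervalIntegrable_iff_integrableOn_Ioc_of_le zero_le_one).1
        (intervalIntegral.intervalIntegrable_rpow' (by linarith))
    refine Integrable.mono' this hmeas.aestronglyMeasurable ?_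
    filter_upwards [ae_restrict_mem measurableSet_Ioc] with t ht
    rw [Real.norm_of_nonneg (hpos t), key t ht.1]
    have h2 : (1 + t ^ 2) ^ (-a / 2) ≤ 1 :=
      Real.rpow_le_one_of_one_le_of_nonpos (by nlinarith) (by linarith)
    have := Real.rpow_nonneg ht.1.le (-e)
    nlinarith
  have h2 : IntegrableOn (fun t : ℝ => (t ^ 2) ^ (-e / 2) * (1 + t ^ 2) ^ (-a / 2)) (Set.Ioi 1) := by
    have : IntegrableOn (fun t : ℝ => t ^ (-e - a)) (Set.Ioi 1) :=
      integrableOn_Ioi_rpow_of_lt (by linarith) one_pos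
    refine Integrable.mono' this hmeas.aestronglyMeasurable ?_
    filter_upwards [ae_restrict_mem measurableSet_Ioi] with t ht
    have ht0 : 0 < t := lt_trans one_pos ht
    rw [Real.norm_of_nonneg (hpos t), key t ht0]
    have h2 : (1 + t ^ 2) ^ (-a / 2) ≤ t ^ (-a) := by
      calc (1 + t ^ 2) ^ (-a / 2) ≤ (t ^ 2) ^ (-a / 2) :=
            Real.rpow_le_rpow_of_nonpos (by positivity) (by linarith) (by linarith)
        _ = t ^ (-a) := by
            rw [← Real.rpow_natCast, ← Real.rpow_mul ht0.le]; congr 1; push_cast; ring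
    rw [sub_eq_add_neg, Real.rpow_add ht0]
    exact mul_le_mul_of_nonneg_left h2 (Real.rpow_nonneg ht0.le _)
  have h3 : IntegrableOn (fun t : ℝ => (t ^ 2) ^ (-e / 2) * (1 + t ^ 2) ^ (-a / 2)) (Set.Ioi 0) := by
    rw [← Set.Ioc_union_Ioi_eq_Ioi zero_le_one]; exact h1.union h2
  have h4 : IntegrableOn (fun t : ℝ => (t ^ 2) ^ (-e / 2) * (1 + t ^ 2) ^ (-a / 2)) (Set.Iic 0) := by
    rw [← Measure.map_neg_eq_self (volume : Measure ℝ)]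
    let m : MeasurableEmbedding fun x : ℝ => -x := (Homeomorph.neg ℝ).measurableEmbedding
    rw [m.integrableOn_map_iff]
    simp_rw [Function.comp_def, neg_sq, Set.neg_preimage, Set.neg_Iic, neg_zero]
    exact Iff.mpr integrableOn_Ici_iff_integrableOn_Ioi h3
  rw [← integrableOn_univ, ← Set.Iic_union_Ioi (a := (0 : ℝ))]
  exact h4.union h3

lemma integrable_model {ι : Type*} [Fintype ι] (S : Finset ι) (lam l : ℝ) (hl : 0 ≤ l)
    (hS : l < S.card) (hlam : (Fintype.card ι : ℝ) - l < lam) :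
    Integrable (fun u : ι → ℝ => (1 + ∑ i, u i ^ 2) ^ (-lam / 2) * (∑ i ∈ S, u i ^ 2) ^ (-l / 2)) := by
  classical
  have hr : (0 : ℝ) < S.card := lt_of_le_of_lt hl hS
  have hSne : S.Nonempty := Finset.card_pos.1 (by exact_mod_cast hr)
  obtain ⟨i0, hi0⟩ := hSne
  have hn : (0 : ℝ) < Fintype.card ι := by
    have : 0 < Fintype.card ι := Fintype.card_pos_iff.2 ⟨i0⟩
    exact_mod_cast this
  set n : ℝ := (Fintype.card ι : ℝ) with hndef
  set δ := (lam - (n - l)) / n with hδ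
  have hδ0 : 0 < δ := div_pos (by linarith) hn
  set r : ℝ := (S.card : ℝ) with hrdef
  have hlr : l / r < 1 := (div_lt_one hr).2 hS
  have hlr0 : 0 ≤ l / r := by positivity
  set e : ι → ℝ := fun i => if i ∈ S then l / r else 0 with he
  have he0 : ∀ i, 0 ≤ e i := fun i => by simp only [he]; split_ifs <;> linarith
  have he1 : ∀ i, e i < 1 := fun i => by simp only [he]; split_ifs <;> linarith
  set a : ι → ℝ := fun i => 1 - e i + δ with ha
  have ha0 : ∀ i, 0 ≤ a i := fun i => by have := he1 i; simp only [ha]; linarith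
  have hesum : ∑ i, e i = l := by
    simp only [he, Finset.sum_ite_mem, Finset.univ_inter, Finset.sum_const, nsmul_eq_mul, ← hrdef]
    field_simp
  have hasum : ∑ i, a i = lam := by
    simp only [ha, Finset.sum_add_distrib, Finset.sum_sub_distrib, hesum, Finset.sum_const,
      Finset.card_univ, nsmul_eq_mul, ← hndef, hδ]
    field_simp
    ring
  have hint : Integrable (fun u : ι → ℝ =>
      ∏ i, ((u i ^ 2) ^ (-e i / 2) * (1 + u i ^ 2) ^ (-a i / 2))) :=
    Integrable.fintype_prod (f := fun i (t : ℝ) => (t ^ 2) ^ (-e i / 2) * (1 + t ^ 2) ^ (-a i / 2))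
      (fun i => integrable_one_dim (e i) (a i) (he0 i) (he1 i) (ha0 i) (by simp only [ha]; linarith))
  refine hint.mono' (by fun_prop) ?_
  have hne : ∀ᵐ u : ι → ℝ, ∀ i, u i ≠ 0 := ae_all_iff.2 fun i =>
    Measure.ae_eval_ne (μ := fun _ : ι => (volume : Measure ℝ)) i 0
  filter_upwards [hne] with u hu
  have hsq : ∀ i, 0 < u i ^ 2 := fun i => by have := hu i; positivity
  have hT : 0 < 1 + ∑ i, u i ^ 2 := by
    have := Finset.sum_nonneg (s := Finset.univ) (fun i _ => (hsq i).le); linarith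
  have hTS : 0 < ∑ i ∈ S, u i ^ 2 := Finset.sum_pos (fun i _ => hsq i) ⟨i0, hi0⟩
  rw [Real.norm_of_nonneg (by positivity), Finset.prod_mul_distrib, mul_comm]
  apply mul_le_mul _ _ (by positivity) (Finset.prod_nonneg fun i _ => by have := hsq i; positivity)
  · have h1 : (∑ i ∈ S, u i ^ 2) ^ (-l / 2) = ∏ i, (∑ i ∈ S, u i ^ 2) ^ (-e i / 2) := by
      rw [← Real.rpow_sum_of_pos hTS]
      congr 1
      rw [← Finset.sum_div, Finset.sum_neg_distrib, hesum]
    rw [h1]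
    refine Finset.prod_le_prod (fun i _ => by positivity) (fun i _ => ?_)
    by_cases hi : i ∈ S
    · refine Real.rpow_le_rpow_of_nonpos (hsq i) ?_ (by have := he0 i; linarith)
      exact Finset.single_le_sum (f := fun i => u i ^ 2) (fun j _ => (hsq j).le) hi
    · simp [he, hi]
  · have h1 : (1 + ∑ i, u i ^ 2) ^ (-lam / 2) = ∏ i, (1 + ∑ i, u i ^ 2) ^ (-a i / 2) := by
      rw [← Real.rpow_sum_of_pos hT]
      congr 1
      rw [← Finset.sum_div, Finset.sum_neg_distrib, hasum]
    rw [h1]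
    refine Finset.prod_le_prod (fun i _ => by positivity) (fun i _ => ?_)
    refine Real.rpow_le_rpow_of_nonpos (by have := hsq i; linarith) ?_ (by have := ha0 i; linarith)
    have := Finset.single_le_sum (f := fun i => u i ^ 2) (fun j _ => (hsq j).le) (Finset.mem_univ i)
    linarith

/-- the model integrand -/
noncomputable def wt {ι κ : Type*} [Fintype ι] [Fintype κ] [DecidableEq κ] (lam l : ℝ)
    (y : Matrix ι κ ℝ) : ℝ :=
  (1 + yᵀ * y).det ^ (-lam / 2) * (yᵀ * y).det ^ (-l / 2)

lemma measurable_wt {X ι κ : Type*} [Fintype ι] [Fintype κ] [DecidableEq κ] (lam l : ℝ)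
    [TopologicalSpace X] [MeasurableSpace X] [OpensMeasurableSpace X]
    (G : X → Matrix ι κ ℝ) (hG : Continuous G) : Measurable (fun p => wt lam l (G p)) := by
  have h1 : Continuous (fun p => (1 + (G p)ᵀ * G p).det) := by fun_prop
  have h2 : Continuous (fun p => ((G p)ᵀ * G p).det) := by fun_prop
  exact (h1.measurable.pow_const _).mul (h2.measurable.pow_const _)

lemma wt_submatrix {ι κ κ' : Type*} [Fintype ι] [Fintype κ] [DecidableEq κ] [Fintype κ']
    [DecidableEq κ'] (lam l : ℝ) (e : κ' ≃ κ) (y : Matrix ι κ ℝ) :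
    wt lam l (y.submatrix id e) = wt lam l y := by
  have h : (y.submatrix id e)ᵀ * y.submatrix id e = (yᵀ * y).submatrix e e := by
    rw [transpose_submatrix, submatrix_mul _ _ _ id _ Function.bijective_id]
  have h1 : (1 : Matrix κ' κ' ℝ) + (yᵀ * y).submatrix e e = (1 + yᵀ * y).submatrix e e := by
    rw [submatrix_add]; simp
  rw [wt, h, h1, det_submatrix_equiv_self, det_submatrix_equiv_self, wt]

lemma det_cols {ι κ : Type*} [Fintype ι] [Fintype κ] [DecidableEq ι] [DecidableEq κ]
    (c : ℝ) (v : ι → ℝ) (Y : Matrix ι κ ℝ) (D : Matrix κ κ ℝ) (hD : D.det ≠ 0) :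
    (fromBlocks (c • (1 : Matrix Unit Unit ℝ) + (replicateCol Unit v)ᵀ * replicateCol Unit v)
      ((replicateCol Unit v)ᵀ * Y) (Yᵀ * replicateCol Unit v) D).det
      = D.det * (c + v ⬝ᵥ ((1 - Y * D⁻¹ * Yᵀ) *ᵥ v)) := by
  have : Invertible D := invertibleOfIsUnitDet D hD.isUnit
  rw [det_fromBlocks₂₂, invOf_eq_nonsing_inv]
  congr 1
  rw [det_unique]
  have : c • (1 : Matrix Unit Unit ℝ) + (replicateCol Unit v)ᵀ * replicateCol Unit v
      - (replicateCol Unit v)ᵀ * Y * D⁻¹ * (Yᵀ * replicateCol Unit v)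
      = c • (1 : Matrix Unit Unit ℝ) +
        (replicateCol Unit v)ᵀ * ((1 - Y * D⁻¹ * Yᵀ) * replicateCol Unit v) := by
    simp only [Matrix.mul_sub, Matrix.sub_mul, Matrix.mul_assoc, Matrix.one_mul]
    abel
  rw [this, ← replicateCol_mulVec]
  simp [Matrix.mul_apply, dotProduct]

lemma gram_cols {ι κ : Type*} [Fintype ι] [Fintype κ]
    (v : ι → ℝ) (Y : Matrix ι κ ℝ) :
    (fromCols (replicateCol Unit v) Y)ᵀ * fromCols (replicateCol Unit v) Y
     = fromBlocks ((replicateCol Unit v)ᵀ * replicateCol Unit v)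
      ((replicateCol Unit v)ᵀ * Y) (Yᵀ * replicateCol Unit v) (Yᵀ * Y) := by
  rw [transpose_fromCols, fromRows_mul_fromCols]

lemma det_gram_cols {ι κ : Type*} [Fintype ι] [Fintype κ] [DecidableEq ι] [DecidableEq κ]
    (v : ι → ℝ) (Y : Matrix ι κ ℝ) (hD : (Yᵀ * Y).det ≠ 0) :
    ((fromCols (replicateCol Unit v) Y)ᵀ * fromCols (replicateCol Unit v) Y).det
      = (Yᵀ * Y).det * (v ⬝ᵥ ((1 - Y * (Yᵀ * Y)⁻¹ * Yᵀ) *ᵥ v)) := by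
  have := det_cols 0 v Y (Yᵀ * Y) hD
  rw [zero_smul, zero_add, zero_add] at this
  rw [gram_cols, this]

lemma det_one_add_gram_cols {ι κ : Type*} [Fintype ι] [Fintype κ] [DecidableEq ι] [DecidableEq κ]
    (v : ι → ℝ) (Y : Matrix ι κ ℝ) :
    (1 + (fromCols (replicateCol Unit v) Y)ᵀ * fromCols (replicateCol Unit v) Y).det
      = (1 + Yᵀ * Y).det * (1 + v ⬝ᵥ ((1 - Y * (1 + Yᵀ * Y)⁻¹ * Yᵀ) *ᵥ v)) := by
  have := det_cols 1 v Y (1 + Yᵀ * Y) (posDef_one_add_gram Y).det_pos.ne'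
  rw [one_smul] at this
  rw [gram_cols, ← fromBlocks_one, fromBlocks_add, zero_add, zero_add, this]

lemma det_gram_cols_zero {ι κ : Type*} [Fintype ι] [Fintype κ] [DecidableEq κ]
    (v : ι → ℝ) (Y : Matrix ι κ ℝ) (hD : (Yᵀ * Y).det = 0) :
    ((fromCols (replicateCol Unit v) Y)ᵀ * fromCols (replicateCol Unit v) Y).det = 0 := by
  obtain ⟨c, hc, hc0⟩ := exists_mulVec_eq_zero_iff.2 hD
  have hYc : Y *ᵥ c = 0 := by
    have h : (Y *ᵥ c) ⬝ᵥ (Y *ᵥ c) = 0 := by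
      rw [dotProduct_mulVec, ← mulVec_transpose, mulVec_mulVec, hc0, zero_dotProduct]
    exact dotProduct_self_eq_zero.1 h
  apply exists_mulVec_eq_zero_iff.1
  refine ⟨Sum.elim 0 c, ?_, ?_⟩
  · intro h
    apply hc
    ext j
    exact congrFun h (Sum.inr j)
  · rw [← mulVec_mulVec, fromCols_mulVec_sumElim, hYc]
    simp

lemma lintegral_linear {ι : Type*} [Fintype ι] [DecidableEq ι] (R : Matrix ι ι ℝ) (hR : R.det ≠ 0)
    (g : (ι → ℝ) → ENNReal) (hg : Measurable g) :
    ∫⁻ v, g v = ENNReal.ofReal |R.det| * ∫⁻ u, g (R *ᵥ u) := by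
  have h := Real.map_matrix_volume_pi_eq_smul_volume_pi hR
  have h1 : ∫⁻ v, g v ∂(Measure.map (toLin' R) volume) = ∫⁻ u, g (R *ᵥ u) := by
    rw [lintegral_map hg (by exact (LinearMap.continuous_of_finiteDimensional _).measurable)]
    simp
  rw [h, lintegral_smul_measure, smul_eq_mul] at h1
  rw [← h1, ← mul_assoc, ← ENNReal.ofReal_mul (abs_nonneg _), ← abs_mul, mul_inv_cancel₀ hR]
  simp

lemma quad_conj {ι : Type*} [Fintype ι] (R A : Matrix ι ι ℝ) (u : ι → ℝ) :
    (R *ᵥ u) ⬝ᵥ (A *ᵥ (R *ᵥ u)) = u ⬝ᵥ ((Rᵀ * A * R) *ᵥ u) := by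
  rw [← mulVec_mulVec, ← mulVec_mulVec, dotProduct_mulVec u, ← mulVec_transpose, transpose_transpose]

/-- integration of one column -/
lemma one_column {ι κ : Type*} [Fintype ι] [Fintype κ] [DecidableEq ι] [DecidableEq κ]
    (lam l : ℝ) (hl : 0 < l) (hκ : l + Fintype.card κ < Fintype.card ι)
    (hlam : (Fintype.card ι : ℝ) - l < lam) :
    ∃ K : ENNReal, K < ⊤ ∧ ∀ Y : Matrix ι κ ℝ,
      ∫⁻ v : ι → ℝ, ENNReal.ofReal (wt lam l (fromCols (replicateCol Unit v) Y))
        ≤ K * ENNReal.ofReal (wt (lam - 1) l Y) := by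
  let g : Finset ι → (ι → ℝ) → ℝ := fun S u =>
    (1 + ∑ i, u i ^ 2) ^ (-lam / 2) * (∑ i ∈ S, u i ^ 2) ^ (-l / 2)
  let T : Finset (Finset ι) := Finset.univ.filter (fun S => S.card + Fintype.card κ = Fintype.card ι)
  refine ⟨∑ S ∈ T, ∫⁻ u, ENNReal.ofReal (g S u), ?_, ?_⟩
  · refine ENNReal.sum_lt_top.2 fun S hS => ?_
    have hS' : S.card + Fintype.card κ = Fintype.card ι := (Finset.mem_filter.1 hS).2
    have hS'' : (S.card : ℝ) + Fintype.card κ = Fintype.card ι := by exact_mod_cast hS'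
    exact (integrable_model S lam l hl.le (by linarith) hlam).lintegral_lt_top
  · intro Y
    by_cases hD : (Yᵀ * Y).det = 0
    · have : ∀ v : ι → ℝ, wt lam l (fromCols (replicateCol Unit v) Y) = 0 := fun v => by
        rw [wt, det_gram_cols_zero v Y hD, Real.zero_rpow (by linarith), mul_zero]
      simp [this]
    · obtain ⟨R, S, hS, hR1, hR2, hRdet⟩ := exists_normal Y hD
      have hEpos := (posDef_one_add_gram Y).det_pos
      have hDpos : 0 < (Yᵀ * Y).det := lt_of_le_of_ne (posSemidef_gram Y).det_nonneg (Ne.symm hD)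
      have hRne : R.det ≠ 0 := by
        intro h
        rw [h, abs_zero] at hRdet
        have := Real.rpow_pos_of_pos hEpos (1 / 2 : ℝ)
        linarith
      have hmeas : Measurable (fun v : ι → ℝ =>
          ENNReal.ofReal (wt lam l (fromCols (replicateCol Unit v) Y))) := by
        refine (measurable_wt lam l _ ?_).ennreal_ofReal
        refine continuous_matrix fun i j => ?_
        rcases j with j | j
        · exact continuous_apply i
        · exact continuous_const
      rw [lintegral_linear R hRne _ hmeas]
      have hval : ∀ u : ι → ℝ, wt lam l (fromCols (replicateCol Unit (R *ᵥ u)) Y)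
          = wt lam l Y * g S u := by
        intro u
        have h1 : u ⬝ᵥ u = ∑ i, u i ^ 2 := by simp [dotProduct, sq]
        have h2 : u ⬝ᵥ (diagonal (fun i => if i ∈ S then (1 : ℝ) else 0) *ᵥ u)
            = ∑ i ∈ S, u i ^ 2 := by
          simp [dotProduct, mulVec_diagonal, sq, Finset.sum_ite_mem]
        rw [wt, det_gram_cols _ Y hD, det_one_add_gram_cols, quad_conj, quad_conj, hR1, hR2, one_mulVec,
          h1, h2, Real.mul_rpow hEpos.le (by positivity), Real.mul_rpow hDpos.le (by positivity), wt]
        ring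
      have hw0 : 0 ≤ wt lam l Y := by rw [wt]; positivity
      simp_rw [hval, ENNReal.ofReal_mul hw0]
      have hgm : Measurable (fun u => ENNReal.ofReal (g S u)) := by
        apply Measurable.ennreal_ofReal
        simp only [g]
        fun_prop
      rw [lintegral_const_mul _ hgm, ← mul_assoc, ← ENNReal.ofReal_mul (abs_nonneg _), mul_comm]
      have hw : |R.det| * wt lam l Y = wt (lam - 1) l Y := by
        rw [hRdet, wt, wt, ← mul_assoc, ← Real.rpow_add hEpos]
        congr 2
        ring
      rw [hw]
      refine mul_le_mul_left ?_ _
      exact Finset.single_le_sum (f := fun S => ∫⁻ u, ENNReal.ofReal (g S u)) (fun _ _ => zero_le)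
        (Finset.mem_filter.2 ⟨Finset.mem_univ S, hS⟩)

lemma lintegral_split {ι : Type*} [Fintype ι] (m : ℕ) (F : (ι → Fin (m + 1) → ℝ) → ENNReal)
    (G : (ι → ℝ) → (ι → Fin m → ℝ) → ENNReal) (hG : Measurable (Function.uncurry G))
    (h : ∀ y, F y = G (fun i => y i 0) (fun i j => y i j.succ)) :
    ∫⁻ y, F y = ∫⁻ Y, ∫⁻ v, G v Y := by
  have h1 : MeasurePreserving (fun (y : ι → Fin (m + 1) → ℝ) (i : ι) =>
      MeasurableEquiv.piFinSuccAbove (fun _ => ℝ) 0 (y i)) volume volume :=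
    volume_preserving_pi (fun _ => volume_preserving_piFinSuccAbove (fun _ => ℝ) 0)
  have h2 := (volume_measurePreserving_arrowProdEquivProdArrow ℝ (Fin m → ℝ) ι).comp h1
  have h3 := h2.lintegral_comp hG
  have h4 : ∫⁻ z, Function.uncurry G z = ∫⁻ Y, ∫⁻ v, G v Y := lintegral_prod_symm' _ hG
  rw [← h4, ← h3]
  refine lintegral_congr fun y => ?_
  rw [h]
  rfl

lemma model_finite {ι : Type*} [Fintype ι] [DecidableEq ι] (l : ℝ) (hl : 0 < l) (m : ℕ) :
    ∀ lam : ℝ, l + m ≤ Fintype.card ι → (Fintype.card ι : ℝ) - l + m - 1 < lam →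
    ∫⁻ y : ι → Fin m → ℝ, ENNReal.ofReal (wt lam l (Matrix.of y)) < ⊤ := by
  induction m with
  | zero =>
    intro lam _ _
    have : ∀ y : ι → Fin 0 → ℝ, wt lam l (Matrix.of y) = 1 := fun y => by simp [wt]
    simp_rw [this]
    rw [lintegral_const]
    simp [volume_pi, Measure.pi_univ]
  | succ m ih =>
    intro lam h1 h2
    push_cast at h1 h2
    obtain ⟨K, hK, hle⟩ := one_column (ι := ι) (κ := Fin m) lam l hl (by simp; linarith)
      (by have : (0 : ℝ) ≤ m := Nat.cast_nonneg m
          linarith)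
    let e : Unit ⊕ Fin m ≃ Fin (m + 1) :=
      ((Equiv.sumComm Unit (Fin m)).trans (Equiv.optionEquivSumPUnit (Fin m)).symm).trans
        (finSuccEquiv m).symm
    rw [lintegral_split m _ (fun v Y =>
      ENNReal.ofReal (wt lam l (fromCols (replicateCol Unit v) (Matrix.of Y))))]
    · refine lt_of_le_of_lt (lintegral_mono fun Y => hle (Matrix.of Y)) ?_
      rw [lintegral_const_mul' _ _ hK.ne]
      exact ENNReal.mul_lt_top hK (ih (lam - 1) (by linarith) (by linarith))
    · refine (measurable_wt lam l (fun p : (ι → ℝ) × (ι → Fin m → ℝ) =>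
        fromCols (replicateCol Unit p.1) (Matrix.of p.2)) ?_).ennreal_ofReal
      refine continuous_matrix fun i j => ?_
      rcases j with j | j
      · exact (continuous_apply i).comp continuous_fst
      · have : Continuous (fun p : (ι → ℝ) × (ι → Fin m → ℝ) => p.2 i j) := by fun_prop
        exact this
    · intro y
      rw [← wt_submatrix lam l e (Matrix.of y)]
      congr 2
      ext i j
      rcases j with j | j
      · simp [e]
      · simp [e]

end RieszAux

/-- for a continuous `f` on `M_{n,m}` (`n = k + l > k ≥ m`) with
`f(x) = O(det(I_m + x'x)^{-λ/2})` and `λ > k + m - 1`, the Riesz potential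
`(I^k f)(x) = γ_{n,m}(k)⁻¹ ∫ f(x-y) det(y'y)^{(k-n)/2} dy` converges absolutely for
every `x`. -/
theorem riesz_potential_convergent (k l m : ℕ) (hm : 0 < m) (hl : 0 < l) (hkm : m ≤ k)
    (f : Matrix (Fin k ⊕ Fin l) (Fin m) ℝ → ℝ) (hf : Continuous f)
    (C lam : ℝ) (hlam : (k : ℝ) + m - 1 < lam)
    (hbound : ∀ x, |f x| ≤ C * ((1 + xᵀ * x).det) ^ (-lam / 2)) :
    ∀ x : Matrix (Fin k ⊕ Fin l) (Fin m) ℝ,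
      Integrable (fun y : Matrix (Fin k ⊕ Fin l) (Fin m) ℝ =>
        f (x - y) * ((yᵀ * y).det) ^ (((k : ℝ) - (k + l)) / 2)) := by
  intro x
  have hl' : (0 : ℝ) < l := by exact_mod_cast hl
  have hk1 : (m : ℝ) ≤ k := by exact_mod_cast hkm
  have hm1 : (1 : ℝ) ≤ m := by exact_mod_cast hm
  have hlam0 : 0 < lam := by linarith
  have hfin := RieszAux.model_finite (ι := Fin k ⊕ Fin l) (l : ℝ) hl' m lam
    (by simp; linarith) (by simp; linarith)
  have hC : 0 ≤ C := by
    have := (abs_nonneg _).trans (hbound 0)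
    simpa using this
  obtain ⟨c, hc, hcomp⟩ := RieszAux.det_compare x
  have hexp : ((k : ℝ) - (k + l)) / 2 = -(l : ℝ) / 2 := by ring
  rw [hexp]
  have hmw := RieszAux.measurable_wt (X := Fin k ⊕ Fin l → Fin m → ℝ) lam l
    (fun y => (Matrix.of y : Matrix (Fin k ⊕ Fin l) (Fin m) ℝ))
    (continuous_matrix fun i j => (continuous_apply j).comp (continuous_apply i))
  have hw0 : ∀ y : Matrix (Fin k ⊕ Fin l) (Fin m) ℝ, 0 ≤ RieszAux.wt lam l y := fun y =>
    mul_nonneg (Real.rpow_nonneg (RieszAux.posDef_one_add_gram y).det_pos.le _)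
      (Real.rpow_nonneg (RieszAux.posSemidef_gram y).det_nonneg _)
  have hint : Integrable (fun y : Fin k ⊕ Fin l → Fin m → ℝ => RieszAux.wt lam l (Matrix.of y)) := by
    refine ⟨hmw.aestronglyMeasurable, ?_⟩
    rw [hasFiniteIntegral_iff_ofReal (Filter.Eventually.of_forall fun y => hw0 _)]
    exact hfin
  have hmain : Integrable (fun y : Fin k ⊕ Fin l → Fin m → ℝ =>
      f (x - Matrix.of y) * (((Matrix.of y)ᵀ * Matrix.of y).det) ^ (-(l : ℝ) / 2)) := by
    refine (hint.const_mul (C * c ^ (lam / 2))).mono' ?_ (Filter.Eventually.of_forall fun y => ?_)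
    · have hof : Continuous (fun y : Fin k ⊕ Fin l → Fin m → ℝ =>
          (Matrix.of y : Matrix (Fin k ⊕ Fin l) (Fin m) ℝ)) :=
        continuous_matrix fun i j => (continuous_apply j).comp (continuous_apply i)
      have h1 : Continuous (fun y : Fin k ⊕ Fin l → Fin m → ℝ => f (x - Matrix.of y)) :=
        hf.comp (continuous_const.sub hof)
      have h2 : Continuous (fun y : Fin k ⊕ Fin l → Fin m → ℝ =>
          ((Matrix.of y)ᵀ * Matrix.of y).det) :=
        (hof.matrix_transpose.matrix_mul hof).matrix_det
      exact (h1.measurable.mul (h2.measurable.pow_const _)).aestronglyMeasurable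
    · generalize (Matrix.of y : Matrix (Fin k ⊕ Fin l) (Fin m) ℝ) = z
      have hz := (RieszAux.posDef_one_add_gram z).det_pos
      have hxz := (RieszAux.posDef_one_add_gram (x - z)).det_pos
      have hg := Real.rpow_nonneg (RieszAux.posSemidef_gram z).det_nonneg (-(l : ℝ) / 2)
      have h3 : (1 + (x - z)ᵀ * (x - z)).det ^ (-lam / 2)
          ≤ c ^ (lam / 2) * (1 + zᵀ * z).det ^ (-lam / 2) := by
        have h4 := Real.rpow_le_rpow_of_nonpos hz (hcomp z) (by linarith : -lam / 2 ≤ 0)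
        rw [Real.mul_rpow hc.le hxz.le] at h4
        have h5 : c ^ (lam / 2) * c ^ (-lam / 2) = 1 := by
          rw [← Real.rpow_add hc]; simp [neg_div]
        calc _ = c ^ (lam / 2) * (c ^ (-lam / 2) * (1 + (x - z)ᵀ * (x - z)).det ^ (-lam / 2)) := by
              rw [← mul_assoc, h5, one_mul]
          _ ≤ _ := mul_le_mul_of_nonneg_left h4 (by positivity)
      rw [norm_mul, Real.norm_eq_abs, Real.norm_of_nonneg hg, RieszAux.wt]
      calc _ ≤ (C * (c ^ (lam / 2) * (1 + zᵀ * z).det ^ (-lam / 2))) * (zᵀ * z).det ^ (-(l : ℝ) / 2) :=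
            mul_le_mul_of_nonneg_right
              ((hbound _).trans (mul_le_mul_of_nonneg_left h3 hC)) hg
        _ = _ := by ring
  exact hmain
end
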